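/- Let K = 𝔽_q(T), q = p^t, P monic irreducible of degree d, α ∈ ℕ with gcd(α, p) = 1, and α₀ = ⌊α/p⌋. The number of distinct Artin–Schreier extensions L = K(y) of K with y^p − y = f(T)/P^α, f ∈ 𝔽_q[T], deg f ≤ dα, gcd(f, P) = 1, equals N_α = (p/(p−1))·Φ(P^{α−α₀}) = (p/(p−1))·q^{(α−α₀−1)d}(q^d − 1). -/

import Mathlib

open Polynomial IntermediateField

section ArtinSchreier

variable {p : ℕ}

theorem exists_map_zmod_eq_of_pow_eq_self [Fact p.Prime] {F : Type*} [Field F] (ι : ZMod p →+* F) {x : F}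
    (hx : x ^ p = x) : ∃ i, ι i = x := by
  have : CharP F p := charP_of_injective_ringHom ι.injective p
  have h : x ∈ (⊥ : Subfield F) := (Subfield.mem_bot_iff_pow_eq_self F p).2 hx
  exact (bot_le : (⊥ : Subfield F) ≤ ι.fieldRange) h

theorem map_zmod_pow_char [Fact p.Prime] {R : Type*} [Semiring R] (ι : ZMod p →+* R) (i : ZMod p) :
    ι i ^ p = ι i := by
  rw [← map_pow, ZMod.pow_card]

variable {K Ω : Type*} [Field K] [Field Ω] [Algebra K Ω]

theorem isSeparable_of_pow_sub_self [CharP K p] {y : Ω} {u : K}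
    (hy : y ^ p - y = algebraMap K Ω u) : IsSeparable K y := by
  have hs : (X ^ p - X - C u : K[X]).Separable := by
    have hd : derivative (X ^ p - X - C u : K[X]) = -1 := by simp [derivative_X_pow]
    rw [Separable, hd]
    exact isCoprime_one_right.neg_right
  refine hs.of_dvd (minpoly.dvd K y ?_)
  simp [hy]

theorem mem_range_algebraMap_of_isSeparable_of_fixed [Normal K Ω] {x : Ω} (hs : IsSeparable K x)
    (hfix : ∀ σ : Gal(Ω/K), σ x = x) : x ∈ Set.range (algebraMap K Ω) := by
  rw [← Algebra.mem_bot]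
  by_contra hx
  obtain ⟨x', hne, hc⟩ := (notMem_iff_exists_ne_and_isConjRoot hs (Normal.splits ‹_› x)).1 hx
  obtain ⟨σ, hσ⟩ := hc.symm.exists_algEquiv
  exact hne ((hfix σ).symm.trans hσ)

theorem algEquiv_eq_of_mem_adjoin_simple {σ τ : Gal(Ω/K)} {x y : Ω} (h : σ y = τ y)
    (hx : x ∈ K⟮y⟯) : σ x = τ x := by
  obtain ⟨r, s, rfl⟩ := (mem_adjoin_simple_iff K x).1 hx
  have key : ∀ (ρ : Gal(Ω/K)) (f : K[X]), ρ (aeval y f) = aeval (ρ y) f := fun ρ f =>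
    (aeval_algHom_apply (ρ : Ω →ₐ[K] Ω) y f).symm
  simp only [map_div₀, key, h]

theorem exists_eq_mul_add_of_mem_adjoin [Fact p.Prime] [Normal K Ω] (ι : ZMod p →+* K) {y z : Ω} {u v : K}
    (hy : y ^ p - y = algebraMap K Ω u) (hz : z ^ p - z = algebraMap K Ω v)
    (hyK : y ∉ Set.range (algebraMap K Ω)) (hzy : z ∈ K⟮y⟯) :
    ∃ (j : ZMod p) (w : K), z = algebraMap K Ω (ι j) * y + algebraMap K Ω w := by
  have : CharP K p := charP_of_injective_ringHom ι.injective p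
  have : CharP Ω p := charP_of_injective_algebraMap (algebraMap K Ω).injective p
  set κ : ZMod p →+* Ω := (algebraMap K Ω).comp ι with hκ
  have hκσ : ∀ (σ : Gal(Ω/K)) i, σ (κ i) = κ i := fun σ i => σ.commutes _
  have shift : ∀ {x : Ω} {a : K}, x ^ p - x = algebraMap K Ω a → ∀ σ : Gal(Ω/K),
      ∃ i, σ x = x + κ i := by
    intro x a hx σ
    obtain ⟨i, hi⟩ := exists_map_zmod_eq_of_pow_eq_self κ (x := σ x - x) (by
      have h := congrArg σ hx
      rw [AlgEquiv.commutes, ← hx, map_sub, map_pow] at h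
      rw [sub_pow_char]
      linear_combination h)
    exact ⟨i, by rw [hi]; ring⟩
  obtain ⟨σ, hσ⟩ : ∃ σ : Gal(Ω/K), σ y ≠ y := by
    by_contra! h
    exact hyK (mem_range_algebraMap_of_isSeparable_of_fixed (isSeparable_of_pow_sub_self hy) h)
  obtain ⟨i, hi⟩ := shift hy σ
  obtain ⟨k, hk⟩ := shift hz σ
  have hi0 : i ≠ 0 := by
    rintro rfl
    simp [hi] at hσ
  set w := z - κ (k / i) * y with hw
  have hσw : σ w = w := by
    have : κ (k / i) * κ i = κ k := by rw [← map_mul, div_mul_cancel₀ _ hi0]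
    rw [hw, map_sub, map_mul, hκσ, hi, hk]
    linear_combination -this
  have hwmem : w ∈ K⟮y⟯ := sub_mem hzy
    (mul_mem (IntermediateField.algebraMap_mem _ _) (mem_adjoin_simple_self K y))
  have hpow : ∀ n : ℕ, (σ ^ n) y = y + n * κ i ∧ (σ ^ n) w = w := by
    intro n
    induction n with
    | zero => simp
    | succ n ih =>
      rw [pow_succ', AlgEquiv.mul_apply, AlgEquiv.mul_apply, ih.1, ih.2, hσw]
      refine ⟨?_, rfl⟩
      rw [map_add, map_mul, hκσ, hi, map_natCast]
      push_cast
      ring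
  have hwp : w ^ p - w = algebraMap K Ω (v - ι (k / i) * u) := by
    rw [hw, sub_pow_char, mul_pow, map_zmod_pow_char, map_sub, map_mul, ← hy, ← hz, hκ,
      RingHom.comp_apply]
    ring
  obtain ⟨w', hw'⟩ : w ∈ Set.range (algebraMap K Ω) := by
    refine mem_range_algebraMap_of_isSeparable_of_fixed (isSeparable_of_pow_sub_self hwp) ?_
    intro τ
    obtain ⟨m, hm⟩ := shift hy τ
    have hn : τ y = (σ ^ (m / i).val) y := by
      rw [hm, (hpow _).1, ← map_natCast κ, ← map_mul, ZMod.natCast_zmod_val,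
        div_mul_cancel₀ _ hi0]
    rw [algEquiv_eq_of_mem_adjoin_simple hn hwmem, (hpow _).2]
  exact ⟨k / i, w', by rw [hw', hw, hκ, RingHom.comp_apply]; ring⟩

theorem card_setOf_pow_sub_self_mem [Fact p.Prime] [IsAlgClosed Ω] (ι : ZMod p →+* K)
    (S : Set K) :
    Nat.card {y : Ω // ∃ u ∈ S, y ^ p - y = algebraMap K Ω u} = Nat.card S * p := by
  have : CharP K p := charP_of_injective_ringHom ι.injective p
  have : CharP Ω p := charP_of_injective_algebraMap (algebraMap K Ω).injective p
  have hroot : ∀ u : K, ∃ y : Ω, y ^ p - y = algebraMap K Ω u := by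
    intro u
    have hd : (X ^ p - X - C (algebraMap K Ω u) : Polynomial Ω).degree ≠ 0 := by
      have h1 : 1 < p := (Fact.out : p.Prime).one_lt
      rw [sub_sub, degree_sub_eq_left_of_degree_lt, degree_X_pow]
      · exact_mod_cast (by omega : p ≠ 0)
      · rw [degree_X_add_C, degree_X_pow]
        exact_mod_cast h1
    obtain ⟨y, hy⟩ := IsAlgClosed.exists_root _ hd
    refine ⟨y, ?_⟩
    simpa [IsRoot, sub_eq_zero] using hy
  choose r hr using hroot
  set κ : ZMod p →+* Ω := (algebraMap K Ω).comp ι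
  have hκ : ∀ (y : Ω) i, (y + κ i) ^ p - (y + κ i) = y ^ p - y := by
    intro y i
    rw [add_pow_char, map_zmod_pow_char]
    ring
  let f : S × ZMod p → {y : Ω // ∃ u ∈ S, y ^ p - y = algebraMap K Ω u} := fun a =>
    ⟨r a.1 + κ a.2, a.1, a.1.2, by rw [hκ, hr]⟩
  have hf : Function.Bijective f := by
    constructor
    · rintro ⟨⟨u, hu⟩, i⟩ ⟨⟨v, hv⟩, j⟩ h
      have h' : r u + κ i = r v + κ j := congrArg Subtype.val h
      obtain rfl : u = v := by
        apply (algebraMap K Ω).injective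
        rw [← hr, ← hr, ← hκ (r u) i, h', hκ]
      obtain rfl : i = j := κ.injective (add_left_cancel h')
      rfl
    · rintro ⟨y, u, hu, hy⟩
      obtain ⟨i, hi⟩ := exists_map_zmod_eq_of_pow_eq_self κ (x := y - r u) (by
        rw [sub_pow_char]
        linear_combination hy - hr u)
      exact ⟨⟨⟨u, hu⟩, i⟩, Subtype.ext (by simp [f, hi])⟩
  rw [← Nat.card_congr (Equiv.ofBijective f hf), Nat.card_prod, Nat.card_zmod]

theorem adjoin_simple_mul_add (y : Ω) {c : K} (hc : c ≠ 0) (w : K) :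
    K⟮algebraMap K Ω c * y + algebraMap K Ω w⟯ = K⟮y⟯ := by
  apply le_antisymm
  · rw [adjoin_simple_le_iff]
    exact add_mem (mul_mem (IntermediateField.algebraMap_mem _ _) (mem_adjoin_simple_self K y))
      (IntermediateField.algebraMap_mem _ _)
  · rw [adjoin_simple_le_iff]
    set z := algebraMap K Ω c * y + algebraMap K Ω w with hz
    have hy : y = algebraMap K Ω c⁻¹ * (z - algebraMap K Ω w) := by
      have : algebraMap K Ω c ≠ 0 := by simpa using hc
      rw [hz, map_inv₀]
      field_simp
      ring
    rw [hy]
    exact mul_mem (IntermediateField.algebraMap_mem _ _)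
      (sub_mem (mem_adjoin_simple_self K z) (IntermediateField.algebraMap_mem _ _))

/-- Count of the Artin–Schreier extensions `K(y)`, `y ^ p - y ∈ S`, when `S` avoids `℘(K)` and
`W` is the set of all `w` relating two elements of `S` by `v = j u + ℘(w)`. -/
theorem card_adjoin_pow_sub_self_mem [Fact p.Prime] [IsAlgClosed Ω] [Normal K Ω]
    (ι : ZMod p →+* K) (S W : Set K)
    (hS : ∀ u ∈ S, ∀ w : K, w ^ p - w ≠ u)
    (hSW : ∀ u ∈ S, ∀ j : ZMod p, j ≠ 0 → ∀ w ∈ W, ι j * u + (w ^ p - w) ∈ S)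
    (hW : ∀ u ∈ S, ∀ v ∈ S, ∀ (j : ZMod p) (w : K), w ^ p - w = v - ι j * u → w ∈ W) :
    Nat.card {L : IntermediateField K Ω //
        ∃ y : Ω, (∃ u ∈ S, y ^ p - y = algebraMap K Ω u) ∧ L = K⟮y⟯} *
      ((p - 1) * Nat.card W) = Nat.card S * p := by
  have : CharP K p := charP_of_injective_ringHom ι.injective p
  have : CharP Ω p := charP_of_injective_algebraMap (algebraMap K Ω).injective p
  have hrange : ∀ (y : Ω), (∃ u ∈ S, y ^ p - y = algebraMap K Ω u) →
      y ∉ Set.range (algebraMap K Ω) := by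
    rintro _ ⟨u, hu, hy⟩ ⟨w, rfl⟩
    refine hS u hu w ((algebraMap K Ω).injective ?_)
    rw [← hy, map_sub, map_pow]
  have hexp : ∀ (y : Ω) (u : K) (j : ZMod p) (w : K), y ^ p - y = algebraMap K Ω u →
      (algebraMap K Ω (ι j) * y + algebraMap K Ω w) ^ p -
        (algebraMap K Ω (ι j) * y + algebraMap K Ω w) =
      algebraMap K Ω (ι j * u + (w ^ p - w)) := by
    intro y u j w hy
    rw [add_pow_char, mul_pow, ← map_pow, map_zmod_pow_char]
    simp only [map_add, map_mul, map_sub, map_pow, ← hy]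
    ring
  rw [← card_setOf_pow_sub_self_mem (Ω := Ω) ι S]
  set N := {L : IntermediateField K Ω //
        ∃ y : Ω, (∃ u ∈ S, y ^ p - y = algebraMap K Ω u) ∧ L = K⟮y⟯}
  choose g hg hgL using fun L : N => L.2
  choose u hu hgu using hg
  let f : N × (ZMod p)ˣ × W → {y : Ω // ∃ u ∈ S, y ^ p - y = algebraMap K Ω u} := fun a =>
    ⟨algebraMap K Ω (ι a.2.1) * g a.1 + algebraMap K Ω a.2.2,
      _, hSW _ (hu a.1) a.2.1 a.2.1.ne_zero a.2.2 a.2.2.2, hexp _ _ _ _ (hgu a.1)⟩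
  have hf : Function.Bijective f := by
    constructor
    · rintro ⟨L, j, w, hw⟩ ⟨L', j', w', hw'⟩ h
      have h' : algebraMap K Ω (ι j) * g L + algebraMap K Ω w =
        algebraMap K Ω (ι j') * g L' + algebraMap K Ω w' := congrArg Subtype.val h
      obtain rfl : L = L' := by
        apply Subtype.ext
        rw [hgL L, hgL L', ← adjoin_simple_mul_add (g L) (c := ι j) (by simp) w, h',
          adjoin_simple_mul_add _ (by simp)]
      have hjj : (j : ZMod p) = j' := by
        by_contra hne
        have hne' : ι j - ι j' ≠ 0 := sub_ne_zero.2 (ι.injective.ne hne)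
        have hne'' : algebraMap K Ω (ι j - ι j') ≠ 0 :=
          (_root_.map_ne_zero _).2 hne'
        refine hrange _ ⟨u L, hu L, hgu L⟩ ⟨(w' - w) / (ι j - ι j'), ?_⟩
        rw [map_div₀, div_eq_iff hne'', map_sub, map_sub]
        linear_combination -h'
      obtain rfl : j = j' := Units.ext hjj
      obtain rfl : w = w' := (algebraMap K Ω).injective (add_left_cancel h')
      rfl
    · rintro ⟨y, v, hv, hy⟩
      let L : N := ⟨K⟮y⟯, y, ⟨v, hv, hy⟩, rfl⟩
      obtain ⟨j, w, hjw⟩ := exists_eq_mul_add_of_mem_adjoin ι (hgu L) hy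
        (hrange _ ⟨_, hu L, hgu L⟩) (by
          rw [← hgL L]
          exact mem_adjoin_simple_self K y)
      have hj : j ≠ 0 := by
        rintro rfl
        exact hrange _ ⟨v, hv, hy⟩ ⟨w, by simp [hjw]⟩
      have hw : w ∈ W := by
        refine hW (u L) (hu L) v hv j w ((algebraMap K Ω).injective ?_)
        have h1 := hexp _ _ j w (hgu L)
        rw [← hjw, hy, map_add] at h1
        rw [map_sub _ v, h1]
        ring
      exact ⟨⟨L, Units.mk0 j hj, w, hw⟩, Subtype.ext hjw.symm⟩
  rw [← Nat.card_congr (Equiv.ofBijective f hf), Nat.card_prod, Nat.card_prod,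
    Nat.card_eq_fintype_card (α := (ZMod p)ˣ), ZMod.card_units]

end ArtinSchreier

section Counting

variable {F : Type*} [Field F]

theorem setOf_degree_le_eq_degreeLT (n : ℕ) :
    {f : F[X] | f.degree ≤ (n : WithBot ℕ)} = (degreeLT F (n + 1) : Set F[X]) := by
  ext f
  rw [Set.mem_ofPred_eq, SetLike.mem_coe, mem_degreeLT, degree_lt_iff_coeff_zero,
    degree_le_iff_coeff_zero]
  simp only [Nat.cast_lt, Nat.succ_le_iff]

theorem finite_setOf_degree_le [Finite F] (n : ℕ) :
    {f : F[X] | f.degree ≤ (n : WithBot ℕ)}.Finite := by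
  rw [setOf_degree_le_eq_degreeLT]
  exact Finite.of_equiv _ (degreeLTEquiv F (n + 1)).toEquiv.symm

theorem ncard_setOf_degree_le [Fintype F] (n : ℕ) :
    {f : F[X] | f.degree ≤ (n : WithBot ℕ)}.ncard = Fintype.card F ^ (n + 1) := by
  rw [setOf_degree_le_eq_degreeLT, ← Nat.card_coe_set_eq]
  refine (Nat.card_congr (degreeLTEquiv F (n + 1)).toEquiv).trans ?_
  simp

theorem degree_le_natDegree_mul_iff {P : F[X]} (hP : P ≠ 0) (f : F[X]) (n : ℕ) :
    (P * f).degree ≤ ((P.natDegree + n : ℕ) : WithBot ℕ) ↔ f.degree ≤ (n : WithBot ℕ) := by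
  rcases eq_or_ne f 0 with rfl | hf
  · simp
  · rw [← natDegree_le_iff_degree_le, ← natDegree_le_iff_degree_le, natDegree_mul hP hf]
    omega

theorem ncard_setOf_degree_le_isCoprime [Fintype F] {P : F[X]} (hP : Irreducible P) {α : ℕ}
    (hα : 0 < α) :
    {f : F[X] | f.degree ≤ ((P.natDegree * α : ℕ) : WithBot ℕ) ∧ IsCoprime f P}.ncard =
      Fintype.card F ^ (P.natDegree * (α - 1) + 1) * (Fintype.card F ^ P.natDegree - 1) := by
  obtain ⟨β, rfl⟩ : ∃ β, α = β + 1 := ⟨α - 1, by omega⟩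
  rw [Nat.add_sub_cancel, mul_add_one, add_comm _ P.natDegree]
  have e : {f : F[X] | f.degree ≤ ((P.natDegree + P.natDegree * β : ℕ) : WithBot ℕ) ∧
        IsCoprime f P} =
      {f : F[X] | f.degree ≤ ((P.natDegree + P.natDegree * β : ℕ) : WithBot ℕ)} \
        ((P * ·) '' {f : F[X] | f.degree ≤ ((P.natDegree * β : ℕ) : WithBot ℕ)}) := by
    ext f
    simp only [Set.mem_ofPred_eq, Set.mem_sdiff, Set.mem_image, isCoprime_comm (x := f),
      hP.coprime_iff_not_dvd]
    refine and_congr_right fun hf => not_congr ⟨?_, ?_⟩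
    · rintro ⟨g, rfl⟩
      exact ⟨g, (degree_le_natDegree_mul_iff hP.ne_zero g _).1 hf, rfl⟩
    · rintro ⟨g, -, rfl⟩
      exact dvd_mul_right P g
  rw [e, Set.ncard_sdiff _ ((finite_setOf_degree_le _).image _),
    Set.ncard_image_of_injective _ (mul_right_injective₀ hP.ne_zero), ncard_setOf_degree_le,
    ncard_setOf_degree_le, Nat.mul_sub, mul_one, ← pow_add]
  · congr 2
    ring
  · rintro _ ⟨g, hg, rfl⟩
    exact (degree_le_natDegree_mul_iff hP.ne_zero g _).2 hg

theorem exists_eq_div_pow_of_pow_sub_self_eq {P : F[X]} (hPm : P.Monic) (hP : Irreducible P)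
    {p α : ℕ} (hp : 2 ≤ p) {g : F[X]} {w : RatFunc F}
    (hw : w ^ p - w = algebraMap F[X] (RatFunc F) g / algebraMap F[X] (RatFunc F) (P ^ α)) :
    ∃ h : F[X], w = algebraMap F[X] (RatFunc F) h / algebraMap F[X] (RatFunc F) (P ^ (α / p)) := by
  set φ := algebraMap F[X] (RatFunc F) with hφ
  have hb : φ w.denom ≠ 0 := RatFunc.algebraMap_ne_zero w.denom_ne_zero
  have hP0 : φ P ≠ 0 := RatFunc.algebraMap_ne_zero hPm.ne_zero
  have hwb : w = φ w.num / φ w.denom := (RatFunc.num_div_denom w).symm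
  obtain ⟨n, rfl⟩ : ∃ n, p = n + 2 := ⟨p - 2, by omega⟩
  have key : P ^ α * (w.num ^ (n + 2) - w.num * w.denom ^ (n + 1)) = g * w.denom ^ (n + 2) := by
    apply RatFunc.algebraMap_injective F
    rw [hwb] at hw
    rw [← hφ]
    simp only [map_mul, map_sub, map_pow, div_pow] at hw ⊢
    field_simp at hw
    refine mul_right_cancel₀ hb ?_
    linear_combination hw
  have hdvd : w.denom ^ (n + 2) ∣ P ^ α := by
    have hc : IsCoprime (w.denom ^ (n + 2)) (w.num ^ (n + 2) - w.num * w.denom ^ (n + 1)) := by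
      refine IsCoprime.pow_left ?_
      have h1 := (w.isCoprime_num_denom.symm.pow_right (n := n + 2)).add_mul_left_right
        (-(w.num * w.denom ^ n))
      have h2 : w.num ^ (n + 2) - w.num * w.denom ^ (n + 1) =
        w.num ^ (n + 2) + w.denom * -(w.num * w.denom ^ n) := by ring
      rwa [h2]
    exact hc.dvd_of_dvd_mul_right ⟨g, by rw [key]; ring⟩
  obtain ⟨k, -, hk⟩ := (dvd_prime_pow hP.prime α).1 ((dvd_pow_self _ (by omega)).trans hdvd)
  have hk' : w.denom = P ^ k := eq_of_monic_of_associated w.monic_denom (hPm.pow k) hk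
  rw [hk', ← pow_mul, pow_dvd_pow_iff hPm.ne_zero hP.not_isUnit] at hdvd
  have hkα : k ≤ α / (n + 2) := (Nat.le_div_iff_mul_le (by omega)).2 hdvd
  refine ⟨w.num * P ^ (α / (n + 2) - k), ?_⟩
  conv_lhs => rw [hwb, hk']
  obtain ⟨m, hm⟩ := Nat.exists_eq_add_of_le hkα
  rw [hm, Nat.add_sub_cancel_left, pow_add]
  simp only [map_mul, map_pow]
  field_simp

theorem pow_sub_self_div {P : F[X]} (hP : P ≠ 0) (p α : ℕ) (h : F[X]) :
    (algebraMap F[X] (RatFunc F) h / algebraMap F[X] (RatFunc F) (P ^ (α / p))) ^ p -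
      algebraMap F[X] (RatFunc F) h / algebraMap F[X] (RatFunc F) (P ^ (α / p)) =
    algebraMap F[X] (RatFunc F) (h ^ p * P ^ (α % p) - h * P ^ (α - α / p)) /
      algebraMap F[X] (RatFunc F) (P ^ α) := by
  have hP0 : algebraMap F[X] (RatFunc F) P ≠ 0 := RatFunc.algebraMap_ne_zero hP
  have h1 : P ^ α = P ^ (α % p) * (P ^ (α / p)) ^ p := by
    rw [← pow_mul, ← pow_add, mul_comm, Nat.mod_add_div]
  have h2 : P ^ α = P ^ (α - α / p) * P ^ (α / p) := by
    rw [← pow_add, Nat.sub_add_cancel (Nat.div_le_self _ _)]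
  rw [map_sub, sub_div]
  congr 1
  · rw [h1]
    simp only [map_mul, map_pow, div_pow]
    field_simp
  · rw [h2]
    simp only [map_mul, map_pow]
    field_simp

theorem degree_pow_mul_sub_le_iff {P : F[X]} (hPm : P.Monic) {p : ℕ} (hp : 2 ≤ p) (α : ℕ)
    (h : F[X]) :
    (h ^ p * P ^ (α % p) - h * P ^ (α - α / p)).degree ≤
      ((P.natDegree * α : ℕ) : WithBot ℕ) ↔
    h.degree ≤ ((P.natDegree * (α / p) : ℕ) : WithBot ℕ) := by
  rcases eq_or_ne h 0 with rfl | h0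
  · simp [show p ≠ 0 by omega]
  set d := P.natDegree
  have n1 : (h ^ p * P ^ (α % p)).natDegree = p * h.natDegree + α % p * d := by
    rw [natDegree_mul (pow_ne_zero _ h0) (pow_ne_zero _ hPm.ne_zero), natDegree_pow,
      natDegree_pow]
  have n2 : (h * P ^ (α - α / p)).natDegree = h.natDegree + (α - α / p) * d := by
    rw [natDegree_mul h0 (pow_ne_zero _ hPm.ne_zero), natDegree_pow]
  obtain ⟨β, γ, hβ, hγ, hα⟩ : ∃ β γ, α / p = β ∧ α % p = γ ∧ α = γ + p * β :=
    ⟨_, _, rfl, rfl, (Nat.mod_add_div _ _).symm⟩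
  obtain ⟨n, rfl⟩ : ∃ n, p = n + 2 := ⟨p - 2, by omega⟩
  have hs : α - β = γ + (n + 1) * β := by
    rw [hα, Nat.sub_eq_iff_eq_add (by nlinarith)]; ring
  rw [hβ, hs] at n2
  rw [hγ] at n1
  rw [← natDegree_le_iff_degree_le, ← natDegree_le_iff_degree_le, hβ, hγ, hs]
  constructor
  · intro hle
    by_contra! hlt
    rw [natDegree_sub_eq_left_of_natDegree_lt (by rw [n1, n2]; nlinarith), n1, hα] at hle
    nlinarith
  · intro hle
    refine (natDegree_sub_le _ _).trans (max_le ?_ ?_)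
    · rw [n1, hα]; nlinarith
    · rw [n2, hα]; nlinarith

end Counting

/-- Let `K = 𝔽_q(T)`, `q = p^t`, `P` monic irreducible of degree
`d`, `α ∈ ℕ` with `p ∤ α`, `α₀ = ⌊α/p⌋`.  The number of distinct Artin–Schreier
extensions `L = K(y)` of `K` (inside a fixed algebraic closure) with
`y^p - y = f/P^α`, `deg f ≤ dα`, `gcd(f, P) = 1`, equals
`N_α = (p/(p-1))·Φ(P^{α-α₀}) = (p/(p-1))·q^{(α-α₀-1)d}(q^d - 1)`;
stated multiplicatively: `(p-1) · #extensions = p · q^{(α-α₀-1)d}·(q^d - 1)`. -/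
theorem stmt11 {p t : ℕ} (hp : p.Prime) (ht : 0 < t)
    (Fq : Type*) [Field Fq] [Fintype Fq] (hq : Fintype.card Fq = p ^ t)
    (P : Polynomial Fq) (hPmonic : P.Monic) (hPirr : Irreducible P)
    (α : ℕ) (hα : ¬ p ∣ α) :
    (p - 1) * Nat.card {L : IntermediateField (RatFunc Fq) (AlgebraicClosure (RatFunc Fq)) //
        ∃ (y : AlgebraicClosure (RatFunc Fq)) (f : Polynomial Fq),
          f.degree ≤ ((P.natDegree * α : ℕ) : WithBot ℕ) ∧ IsCoprime f P ∧
          y ^ p - y = algebraMap (RatFunc Fq) (AlgebraicClosure (RatFunc Fq))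
            (algebraMap (Polynomial Fq) (RatFunc Fq) f /
              algebraMap (Polynomial Fq) (RatFunc Fq) (P ^ α)) ∧
          L = IntermediateField.adjoin (RatFunc Fq) {y}} =
      p * Fintype.card Fq ^ ((α - α / p - 1) * P.natDegree) *
        (Fintype.card Fq ^ P.natDegree - 1) := by
  have : Fact p.Prime := ⟨hp⟩
  have : CharP Fq p := charP_of_card_eq_prime_pow hq
  have hP0 : P ≠ 0 := hPmonic.ne_zero
  have hα0 : 0 < α := Nat.pos_of_ne_zero (by rintro rfl; exact hα (dvd_zero p))
  have hαlt : α / p < α := Nat.div_lt_self hα0 hp.one_lt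
  set φ := algebraMap (Polynomial Fq) (RatFunc Fq) with hφ
  let ι₀ : ZMod p →+* Polynomial Fq := C.comp (ZMod.castHom dvd_rfl Fq)
  have hι₀deg : ∀ (j : ZMod p) (f : Polynomial Fq) (n : WithBot ℕ), f.degree ≤ n →
      (ι₀ j * f).degree ≤ n := fun j f n hf => by
    change (C _ * f).degree ≤ n
    rw [← smul_eq_C_mul]
    exact (degree_smul_le _ _).trans hf
  have hφdiv : ∀ n : ℕ, Function.Injective fun f => φ f / φ (P ^ n) := fun n f g h =>
    RatFunc.algebraMap_injective Fq
      ((div_left_inj' (RatFunc.algebraMap_ne_zero (pow_ne_zero n hP0))).1 h)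
  -- numerator of `℘(h / P ^ (α / p))` over `P ^ α`
  let N : Polynomial Fq → Polynomial Fq := fun h => h ^ p * P ^ (α % p) - h * P ^ (α - α / p)
  have hNdvd : ∀ h, P ∣ N h := fun h => dvd_sub
    (Dvd.dvd.mul_left (dvd_pow_self P fun h0 => hα (Nat.dvd_of_mod_eq_zero h0)) _)
    (Dvd.dvd.mul_left (dvd_pow_self P (by omega)) _)
  let S₀ : Set (Polynomial Fq) :=
    {f | f.degree ≤ ((P.natDegree * α : ℕ) : WithBot ℕ) ∧ IsCoprime f P}
  let W₀ : Set (Polynomial Fq) :=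
    {h | h.degree ≤ ((P.natDegree * (α / p) : ℕ) : WithBot ℕ)}
  have key := card_adjoin_pow_sub_self_mem (Ω := AlgebraicClosure (RatFunc Fq)) (φ.comp ι₀)
    ((fun f => φ f / φ (P ^ α)) '' S₀) ((fun h => φ h / φ (P ^ (α / p))) '' W₀) ?_ ?_ ?_
  · simp only [Nat.card_coe_set_eq, Set.ncard_image_of_injective _ (hφdiv _)] at key
    rw [ncard_setOf_degree_le_isCoprime hPirr hα0, ncard_setOf_degree_le] at key
    have hset : ∀ L : IntermediateField (RatFunc Fq) (AlgebraicClosure (RatFunc Fq)),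
        (∃ y, (∃ u ∈ (fun f => φ f / φ (P ^ α)) '' S₀, y ^ p - y = algebraMap _ _ u) ∧
          L = (RatFunc Fq)⟮y⟯) ↔
        ∃ (y : AlgebraicClosure (RatFunc Fq)) (f : Polynomial Fq),
          f.degree ≤ ((P.natDegree * α : ℕ) : WithBot ℕ) ∧ IsCoprime f P ∧
          y ^ p - y = algebraMap (RatFunc Fq) (AlgebraicClosure (RatFunc Fq))
            (φ f / φ (P ^ α)) ∧ L = (RatFunc Fq)⟮y⟯ := by
      intro L
      constructor
      · rintro ⟨y, ⟨_, ⟨f, hf, rfl⟩, hy⟩, hL⟩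
        exact ⟨y, f, hf.1, hf.2, hy, hL⟩
      · rintro ⟨y, f, hf, hc, hy, hL⟩
        exact ⟨y, ⟨_, ⟨f, ⟨hf, hc⟩, rfl⟩, hy⟩, hL⟩
    rw [Nat.card_congr (Equiv.subtypeEquivRight hset)] at key
    refine Nat.eq_of_mul_eq_mul_right
      (pow_pos Fintype.card_pos (P.natDegree * (α / p) + 1) : 0 < Fintype.card Fq ^ _) ?_
    have hexp : P.natDegree * (α - 1) + 1 =
        (α - α / p - 1) * P.natDegree + (P.natDegree * (α / p) + 1) := by
      obtain ⟨m, hm⟩ := Nat.exists_eq_add_of_lt hαlt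
      have h1 : α - 1 = α / p + m := by omega
      have h2 : α - α / p - 1 = m := by omega
      rw [h1, h2]
      ring
    rw [hexp, pow_add] at key
    linear_combination key
  · rintro _ ⟨f, hf, rfl⟩ w hw
    obtain ⟨h, rfl⟩ := exists_eq_div_pow_of_pow_sub_self_eq hPmonic hPirr hp.two_le hw
    rw [pow_sub_self_div hP0] at hw
    exact hPirr.coprime_iff_not_dvd.1 hf.2.symm (hφdiv α hw ▸ hNdvd h)
  · rintro _ ⟨f, hf, rfl⟩ j hj _ ⟨h, hh, rfl⟩
    refine ⟨ι₀ j * f + N h, ⟨(degree_add_le _ _).trans (max_le (hι₀deg _ _ _ hf.1) ?_), ?_⟩, ?_⟩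
    · exact (degree_pow_mul_sub_le_iff hPmonic hp.two_le α h).2 hh
    · obtain ⟨k, hk⟩ := hNdvd h
      rw [hk]
      have hu : IsUnit (ι₀ j) := hj.isUnit.map ι₀
      exact ((isCoprime_mul_unit_left_left hu f P).2 hf.2).add_mul_left_left k
    · rw [pow_sub_self_div hP0, ← hφ, RingHom.comp_apply φ ι₀, ← mul_div_assoc, ← add_div,
        ← map_mul, ← map_add]
  · rintro _ ⟨f, hf, rfl⟩ _ ⟨g, hg, rfl⟩ j w hw
    have hw' : w ^ p - w = φ (g - ι₀ j * f) / φ (P ^ α) := by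
      rw [hw, RingHom.comp_apply φ ι₀, ← mul_div_assoc, ← sub_div, ← map_mul, ← map_sub]
    obtain ⟨h, rfl⟩ := exists_eq_div_pow_of_pow_sub_self_eq hPmonic hPirr hp.two_le hw'
    refine ⟨h, ?_, rfl⟩
    rw [pow_sub_self_div hP0] at hw'
    refine (degree_pow_mul_sub_le_iff hPmonic hp.two_le α h).1 ?_
    rw [hφdiv α hw']
    exact (degree_sub_le _ _).trans (max_le hg.1 (hι₀deg _ _ _ hf.1))
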